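/- For every natural number k and every robust maximal independent set M of the graph G_k, exactly one of the two vertices b_k and β_k belongs to M. -/

import Mathlib

/-- A set of vertices is independent in `G` if no two of its members are adjacent. -/
def IsIndep {V : Type*} (G : SimpleGraph V) (M : Set V) : Prop :=
  ∀ ⦃u⦄, u ∈ M → ∀ ⦃v⦄, v ∈ M → ¬ G.Adj u v

/-- A maximal independent set of `G`: independent and maximal w.r.t. inclusion among
independent sets of `G`. -/
def IsMIS {V : Type*} (G : SimpleGraph V) (M : Set V) : Prop :=
  IsIndep G M ∧ ∀ S : Set V, IsIndep G S → M ⊆ S → S = M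

/-- A robust MIS of `G`: an MIS of `G` that remains a maximal independent set in every
connected spanning subgraph of `G` (a spanning subgraph being a graph on the same vertex
set whose edge set is contained in that of `G`). -/
def IsRobustMIS {V : Type*} (G : SimpleGraph V) (M : Set V) : Prop :=
  IsMIS G M ∧ ∀ H : SimpleGraph V, H ≤ G → H.Connected → IsMIS H M

/-- Vertices of the graph `G_k`: six families `a_i, b_i, c_i, α_i, β_i, γ_i` for `0 ≤ i ≤ k`. -/
inductive GV (k : ℕ) : Type
  | a : Fin (k + 1) → GV k
  | b : Fin (k + 1) → GV k
  | c : Fin (k + 1) → GV k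
  | al : Fin (k + 1) → GV k  -- α
  | be : Fin (k + 1) → GV k  -- β
  | ga : Fin (k + 1) → GV k  -- γ
  deriving DecidableEq

/-- Base relation generating the edges of `G_k`: the 6-cycle
`a₀–b₀–c₀–γ₀–β₀–α₀–a₀` of `G₀`, and for each `1 ≤ i ≤ k` the edges
`{β_{i-1},α_i}, {β_{i-1},γ_i}, {α_i,β_i}, {γ_i,β_i}, {b_{i-1},a_i}, {b_{i-1},c_i},
{a_i,b_i}, {c_i,b_i}`. -/
def gkRel (k : ℕ) : GV k → GV k → Prop
  | GV.a i, GV.b j => i = j ∨ (i : ℕ) = (j : ℕ) + 1      -- a_i–b_i and b_{i-1}–a_i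
  | GV.b i, GV.c j => i = j ∨ (j : ℕ) = (i : ℕ) + 1      -- b_i–c_i and b_{i-1}–c_i
  | GV.al i, GV.be j => i = j ∨ (i : ℕ) = (j : ℕ) + 1    -- α_i–β_i and β_{i-1}–α_i
  | GV.be i, GV.ga j => i = j ∨ (j : ℕ) = (i : ℕ) + 1    -- β_i–γ_i and β_{i-1}–γ_i
  | GV.c i, GV.ga j => i = 0 ∧ j = 0                     -- c₀–γ₀
  | GV.al i, GV.a j => i = 0 ∧ j = 0                     -- α₀–a₀
  | _, _ => False

/-- The graph `G_k`. -/
def Gk (k : ℕ) : SimpleGraph (GV k) := SimpleGraph.fromRel (gkRel k)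

/-- The set `M1 = {α_i, γ_i, b_i : 0 ≤ i ≤ k}`. -/
def M1 (k : ℕ) : Set (GV k) :=
  {v | ∃ i : Fin (k + 1), v = GV.al i ∨ v = GV.ga i ∨ v = GV.b i}

/-- The set `M2 = {a_i, c_i, β_i : 0 ≤ i ≤ k}`. -/
def M2 (k : ℕ) : Set (GV k) :=
  {v | ∃ i : Fin (k + 1), v = GV.a i ∨ v = GV.c i ∨ v = GV.be i}

/-- A vertex outside a maximal independent set has a neighbour in the set. -/
theorem IsMIS.exists_adj {V : Type*} {G : SimpleGraph V} {M : Set V} (h : IsMIS G M) {v : V}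
    (hv : v ∉ M) : ∃ x ∈ M, G.Adj v x := by
  by_contra! hno
  refine hv (h.2 (insert v M) ?_ (Set.subset_insert v M) ▸ Set.mem_insert v M)
  rintro x (rfl | hx) y (rfl | hy) hxy
  · exact hxy.ne rfl
  · exact hno y hy hxy
  · exact hno x hx hxy.symm
  · exact h.1 hx hy hxy

/-- A vertex `v` outside a robust maximal independent set has a neighbour in the set other than `w`,
whenever `v` and `w` stay connected after deletion of the edge between them. -/
theorem IsRobustMIS.exists_adj_ne {V : Type*} {G : SimpleGraph V} {M : Set V}
    (h : IsRobustMIS G M) (hG : G.Connected) {v : V} (hv : v ∉ M) (w : V)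
    (hr : (G.deleteEdges {s(v, w)}).Reachable v w) : ∃ x ∈ M, G.Adj v x ∧ x ≠ w := by
  have hc := hG.connected_delete_edge_of_not_isBridge (not_not_intro hr)
  obtain ⟨x, hx, hvx⟩ := (h.2 _ (SimpleGraph.deleteEdges_le _) hc).exists_adj hv
  rw [SimpleGraph.deleteEdges_adj] at hvx
  exact ⟨x, hx, hvx.1, fun hxw => hvx.2 (by simp [hxw])⟩

theorem Gk_connected (k : ℕ) : (Gk k).Connected := by
  have hb : ∀ i : Fin (k + 1), (Gk k).Reachable (GV.b 0) (GV.b i) := by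
    intro i
    induction i using Fin.induction with
    | zero => rfl
    | succ i ih =>
      have h₁ : (Gk k).Adj (GV.b i.castSucc) (GV.a i.succ) := by simp [Gk, gkRel]
      have h₂ : (Gk k).Adj (GV.a i.succ) (GV.b i.succ) := by simp [Gk, gkRel]
      exact ih.trans (h₁.reachable.trans h₂.reachable)
  have ha : ∀ i : Fin (k + 1), (Gk k).Reachable (GV.b 0) (GV.a i) := fun i =>
    (hb i).trans (SimpleGraph.Adj.reachable (by simp [Gk, gkRel]))
  have hal : (Gk k).Reachable (GV.b 0) (GV.al 0) :=
    (ha 0).trans (SimpleGraph.Adj.reachable (by simp [Gk, gkRel]))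
  have hbe : ∀ i : Fin (k + 1), (Gk k).Reachable (GV.b 0) (GV.be i) := by
    intro i
    induction i using Fin.induction with
    | zero => exact hal.trans (SimpleGraph.Adj.reachable (by simp [Gk, gkRel]))
    | succ i ih =>
      have h₁ : (Gk k).Adj (GV.be i.castSucc) (GV.al i.succ) := by simp [Gk, gkRel]
      have h₂ : (Gk k).Adj (GV.al i.succ) (GV.be i.succ) := by simp [Gk, gkRel]
      exact ih.trans (h₁.reachable.trans h₂.reachable)
  refine (SimpleGraph.connected_iff_exists_forall_reachable _).2 ⟨GV.b 0, ?_⟩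
  rintro (i | i | i | i | i | i)
  · exact ha i
  · exact hb i
  · exact (hb i).trans (SimpleGraph.Adj.reachable (by simp [Gk, gkRel]))
  · exact (hbe i).trans (SimpleGraph.Adj.reachable (by simp [Gk, gkRel]))
  · exact hbe i
  · exact (hbe i).trans (SimpleGraph.Adj.reachable (by simp [Gk, gkRel]))

theorem reachable_of_path_three {V : Type*} {H : SimpleGraph V} {u v w x : V} (h₁ : H.Adj u v)
    (h₂ : H.Adj v w) (h₃ : H.Adj w x) : H.Reachable u x :=
  h₁.reachable.trans (h₂.reachable.trans h₃.reachable)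

theorem reachable_of_path_five {V : Type*} {H : SimpleGraph V} {u v w x y z : V} (h₁ : H.Adj u v)
    (h₂ : H.Adj v w) (h₃ : H.Adj w x) (h₄ : H.Adj x y) (h₅ : H.Adj y z) : H.Reachable u z :=
  (reachable_of_path_three h₁ h₂ h₃).trans (h₄.reachable.trans h₅.reachable)

section

variable {k : ℕ} {M : Set (GV k)}

theorem b_castSucc_mem_iff (hM : IsRobustMIS (Gk k) M) (i : Fin k) :
    GV.b i.castSucc ∈ M ↔ GV.b i.succ ∈ M := by
  have h₁ : (Gk k).Adj (GV.b i.castSucc) (GV.a i.succ) := by simp [Gk, gkRel]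
  have h₂ : (Gk k).Adj (GV.b i.succ) (GV.a i.succ) := by simp [Gk, gkRel]
  have hne : i.succ ≠ i.castSucc := Fin.castSucc_lt_succ.ne'
  by_cases ha : GV.a i.succ ∈ M
  · exact iff_of_false (fun h => hM.1.1 h ha h₁) (fun h => hM.1.1 h ha h₂)
  · refine iff_of_true ?_ ?_
    · obtain ⟨x, hx, hadj, hxne⟩ := hM.exists_adj_ne (Gk_connected k) ha (GV.b i.succ)
        (reachable_of_path_three (v := GV.b i.castSucc) (w := GV.c i.succ)
          (by simp [Gk, gkRel, hne, hne.symm]) (by simp [Gk, gkRel])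
          (by simp [Gk, gkRel]))
      cases x <;> simp_all [Gk, gkRel]
      grind [Fin.ext_iff]
    · obtain ⟨x, hx, hadj, hxne⟩ := hM.exists_adj_ne (Gk_connected k) ha (GV.b i.castSucc)
        (reachable_of_path_three (v := GV.b i.succ) (w := GV.c i.succ)
          (by simp [Gk, gkRel, hne]) (by simp [Gk, gkRel])
          (by simp [Gk, gkRel]))
      cases x <;> simp_all [Gk, gkRel]
      grind [Fin.ext_iff]

theorem be_castSucc_mem_iff (hM : IsRobustMIS (Gk k) M) (i : Fin k) :
    GV.be i.castSucc ∈ M ↔ GV.be i.succ ∈ M := by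
  have h₁ : (Gk k).Adj (GV.be i.castSucc) (GV.al i.succ) := by simp [Gk, gkRel]
  have h₂ : (Gk k).Adj (GV.be i.succ) (GV.al i.succ) := by simp [Gk, gkRel]
  have hne : i.succ ≠ i.castSucc := Fin.castSucc_lt_succ.ne'
  by_cases ha : GV.al i.succ ∈ M
  · exact iff_of_false (fun h => hM.1.1 h ha h₁) (fun h => hM.1.1 h ha h₂)
  · refine iff_of_true ?_ ?_
    · obtain ⟨x, hx, hadj, hxne⟩ := hM.exists_adj_ne (Gk_connected k) ha (GV.be i.succ)
        (reachable_of_path_three (v := GV.be i.castSucc) (w := GV.ga i.succ)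
          (by simp [Gk, gkRel, hne, hne.symm]) (by simp [Gk, gkRel])
          (by simp [Gk, gkRel]))
      cases x <;> simp_all [Gk, gkRel]
      grind [Fin.ext_iff]
    · obtain ⟨x, hx, hadj, hxne⟩ := hM.exists_adj_ne (Gk_connected k) ha (GV.be i.castSucc)
        (reachable_of_path_three (v := GV.be i.succ) (w := GV.ga i.succ)
          (by simp [Gk, gkRel, hne]) (by simp [Gk, gkRel])
          (by simp [Gk, gkRel]))
      cases x <;> simp_all [Gk, gkRel]
      grind [Fin.ext_iff]

theorem xor_b_zero_be_zero (hM : IsRobustMIS (Gk k) M) :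
    Xor (GV.b 0 ∈ M) (GV.be 0 ∈ M) := by
  have hba : (Gk k).Adj (GV.b 0) (GV.a 0) := by simp [Gk, gkRel]
  have haal : (Gk k).Adj (GV.a 0) (GV.al 0) := by simp [Gk, gkRel]
  have halbe : (Gk k).Adj (GV.al 0) (GV.be 0) := by simp [Gk, gkRel]
  by_cases ha : GV.a 0 ∈ M
  · have hal : GV.al 0 ∉ M := fun h => hM.1.1 ha h haal
    refine Or.inr ⟨?_, fun h => hM.1.1 h ha hba⟩
    obtain ⟨x, hx, hadj, hxne⟩ := hM.exists_adj_ne (Gk_connected k) hal (GV.a 0)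
      (reachable_of_path_five (v := GV.be 0) (w := GV.ga 0) (x := GV.c 0) (y := GV.b 0)
        (by simp [Gk, gkRel]) (by simp [Gk, gkRel]) (by simp [Gk, gkRel]) (by simp [Gk, gkRel])
        (by simp [Gk, gkRel]))
    cases x <;> simp_all [Gk, gkRel]
  · have hb : GV.b 0 ∈ M := by
      obtain ⟨x, hx, hadj, hxne⟩ := hM.exists_adj_ne (Gk_connected k) ha (GV.al 0)
        (reachable_of_path_five (v := GV.b 0) (w := GV.c 0) (x := GV.ga 0) (y := GV.be 0)
          (by simp [Gk, gkRel]) (by simp [Gk, gkRel]) (by simp [Gk, gkRel]) (by simp [Gk, gkRel])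
          (by simp [Gk, gkRel]))
      cases x <;> simp_all [Gk, gkRel]
    have hal : GV.al 0 ∈ M := by
      obtain ⟨x, hx, hadj, hxne⟩ := hM.exists_adj_ne (Gk_connected k) ha (GV.b 0)
        (reachable_of_path_five (v := GV.al 0) (w := GV.be 0) (x := GV.ga 0) (y := GV.c 0)
          (by simp [Gk, gkRel]) (by simp [Gk, gkRel]) (by simp [Gk, gkRel]) (by simp [Gk, gkRel])
          (by simp [Gk, gkRel]))
      cases x <;> simp_all [Gk, gkRel]
    exact Or.inl ⟨hb, fun h => hM.1.1 hal h halbe⟩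

end

/-- For every `k` and every robust MIS `M` of `G_k`, exactly one of the two
vertices `b_k` and `β_k` belongs to `M`. -/
theorem stmt_11 (k : ℕ) (M : Set (GV k)) (hM : IsRobustMIS (Gk k) M) :
    Xor' (GV.b (Fin.last k) ∈ M) (GV.be (Fin.last k) ∈ M) := by
  suffices ∀ i : Fin (k + 1), Xor (GV.b i ∈ M) (GV.be i ∈ M) from this (Fin.last k)
  intro i
  induction i using Fin.induction with
  | zero => exact xor_b_zero_be_zero hM
  | succ i ih => rwa [← b_castSucc_mem_iff hM, ← be_castSucc_mem_iff hM]
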